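/- arXiv:1911.09378 — 2 statements merged into one kernel-verified Lean document; each statement's English description precedes it below -/
import Mathlib

section
/- Let n ≥ 1 and let γ_j, ε_j, δ_j, η_j ∈ ℂ for 1 ≤ j ≤ n satisfy γ_j ≠ 0 and γ_j·η_j − δ_j·ε_j = 1 for every j. Define the 2n×2n complex block matrices G₀ = [[0, 𝔍ₙ],[A, B]] and G₁ = [[𝔍ₙ, 0],[C, D]], where A, B, C, D are the n×n antidiagonal matrices with A_{i,j} = γ_j, B_{i,j} = ε_j, C_{i,j} = δ_j, D_{i,j} = η_j whenever i + j = n + 1 and 0 otherwise. Then G₀ is invertible and G₁·G₀^{-1} = [[P, Q],[Q, R]], where P, Q, R are the n×n diagonal matrices with entries P_{i,i} = −ε_{n+1−i}/γ_{n+1−i}, Q_{i,i} = 1/γ_{n+1−i}, and R_{i,i} = δ_{n+1−i}/γ_{n+1−i}. -/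
open Matrix

noncomputable section

/-- The antidiagonal matrix whose nonzero entry in column `j` is `a j`. -/
def antidiagonalMatrix {R : Type*} [Zero R] {n : ℕ} (a : Fin n → R) : Matrix (Fin n) (Fin n) R :=
  Matrix.of fun i j => if j = Fin.rev i then a j else 0

theorem antidiagonalMatrix_mul {R : Type*} [NonUnitalNonAssocSemiring R] {n : ℕ}
    (a b : Fin n → R) :
    antidiagonalMatrix a * antidiagonalMatrix b =
      Matrix.diagonal fun i => a (Fin.rev i) * b i := by
  ext i j
  rw [Matrix.mul_apply, Finset.sum_eq_single (Fin.rev i)]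
  · by_cases h : i = j
    · simp [antidiagonalMatrix, h]
    · simp [antidiagonalMatrix, h, Ne.symm h]
  · intro k _ hk
    simp [antidiagonalMatrix, hk]
  · simp

/-- the block computation `G₁ · G₀⁻¹` producing the Weyl
`m`-function `M₀ⁿ(λ)` for the natural boundary triple of the `n`-th power of
the Jacobi operator. Here all vectors are indexed by `Fin n`, corresponding to
the paper's `1`-indexed `γ_j, ε_j, δ_j, η_j` (so paper index `n + 1 - i`
corresponds to `Fin.rev i`), and `𝔍ₙ` is the antidiagonal matrix of `1`'s. -/
theorem jacobi_power_weyl_m0_block_computation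
    (n : ℕ) (hn : 1 ≤ n) (γ ε δ η : Fin n → ℂ)
    (hγ : ∀ j, γ j ≠ 0) (hW : ∀ j, γ j * η j - δ j * ε j = 1) :
    let J : Matrix (Fin n) (Fin n) ℂ := fun i j => if j = Fin.rev i then 1 else 0
    let A : Matrix (Fin n) (Fin n) ℂ := fun i j => if j = Fin.rev i then γ j else 0
    let B : Matrix (Fin n) (Fin n) ℂ := fun i j => if j = Fin.rev i then ε j else 0
    let C : Matrix (Fin n) (Fin n) ℂ := fun i j => if j = Fin.rev i then δ j else 0
    let D : Matrix (Fin n) (Fin n) ℂ := fun i j => if j = Fin.rev i then η j else 0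
    let G₀ : Matrix (Fin n ⊕ Fin n) (Fin n ⊕ Fin n) ℂ := Matrix.fromBlocks 0 J A B
    let G₁ : Matrix (Fin n ⊕ Fin n) (Fin n ⊕ Fin n) ℂ := Matrix.fromBlocks J 0 C D
    IsUnit G₀ ∧
      G₁ * G₀⁻¹ =
        Matrix.fromBlocks
          (Matrix.diagonal fun i => -ε (Fin.rev i) / γ (Fin.rev i))
          (Matrix.diagonal fun i => (γ (Fin.rev i))⁻¹)
          (Matrix.diagonal fun i => (γ (Fin.rev i))⁻¹)
          (Matrix.diagonal fun i => δ (Fin.rev i) / γ (Fin.rev i)) := by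
  intro J A B C D G₀ G₁
  have hG₀ : G₀ = Matrix.fromBlocks 0 (antidiagonalMatrix 1)
      (antidiagonalMatrix γ) (antidiagonalMatrix ε) := rfl
  have hG₁ : G₁ = Matrix.fromBlocks (antidiagonalMatrix 1) 0
      (antidiagonalMatrix δ) (antidiagonalMatrix η) := rfl
  have hinv : G₀ * Matrix.fromBlocks
      (antidiagonalMatrix fun j => -ε (Fin.rev j) / γ (Fin.rev j))
      (antidiagonalMatrix fun j => (γ (Fin.rev j))⁻¹) (antidiagonalMatrix 1) 0 = 1 := by
    rw [hG₀, Matrix.fromBlocks_multiply, ← Matrix.fromBlocks_one]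
    simp only [antidiagonalMatrix_mul, Matrix.diagonal_add, zero_mul, mul_zero, zero_add, add_zero,
      Pi.one_apply, mul_one, Matrix.diagonal_one]
    congr 1
    · rw [← Matrix.diagonal_zero]
      congr 1
      funext i
      have h := hγ (Fin.rev i)
      field_simp
      ring
    · rw [← Matrix.diagonal_one]
      congr 1
      funext i
      exact mul_inv_cancel₀ (hγ _)
  refine ⟨IsUnit.of_mul_eq_one _ hinv, ?_⟩
  rw [Matrix.inv_eq_right_inv hinv, hG₁, Matrix.fromBlocks_multiply]
  simp only [antidiagonalMatrix_mul, Matrix.diagonal_add, zero_mul, mul_zero, add_zero,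
    Pi.one_apply, one_mul, mul_one, ← div_eq_mul_inv, one_div]
  congr 2
  funext i
  have h := hγ (Fin.rev i)
  field_simp
  linear_combination hW (Fin.rev i)
end
end

section
/- Let n ≥ 1 and let γ_j, ε_j, δ_j, η_j ∈ ℂ for 1 ≤ j ≤ n satisfy η_j ≠ 0 and γ_j·η_j − δ_j·ε_j = 1 for every j. Define the 2n×2n complex block matrices G₀ = [[0, 𝔍ₙ],[A, B]] and G₁ = [[𝔍ₙ, 0],[C, D]], where A, B, C, D are the n×n antidiagonal matrices with A_{i,j} = γ_j, B_{i,j} = ε_j, C_{i,j} = δ_j, D_{i,j} = η_j whenever i + j = n + 1 and 0 otherwise. Then G₁ is invertible and G₀·G₁^{-1} = [[P′, Q′],[Q′, R′]], where P′, Q′, R′ are the n×n diagonal matrices with entries P′_{i,i} = −δ_{n+1−i}/η_{n+1−i}, Q′_{i,i} = 1/η_{n+1−i}, and R′_{i,i} = ε_{n+1−i}/η_{n+1−i}. -/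
open Matrix

noncomputable section

namespace Matrix

variable {n : ℕ} {R : Type*} [CommRing R]

/-- The antidiagonal matrix whose nonzero entry in column `j` is `a j`. -/
def antidiagonal (a : Fin n → R) : Matrix (Fin n) (Fin n) R :=
  fun i j => if j = Fin.rev i then a j else 0

theorem antidiagonal_mul_antidiagonal (a b : Fin n → R) :
    antidiagonal a * antidiagonal b = diagonal fun i => a (Fin.rev i) * b i := by
  ext i j
  rw [mul_apply, Finset.sum_eq_single (Fin.rev i)]
  · by_cases h : i = j
    · simp [antidiagonal, h]
    · simp [antidiagonal, h, Ne.symm h]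
  · intro k _ hk
    simp [antidiagonal, hk]
  · simp

theorem diagonal_mul_antidiagonal (d a : Fin n → R) :
    diagonal d * antidiagonal a = antidiagonal fun j => d (Fin.rev j) * a j := by
  ext i j
  by_cases h : j = Fin.rev i
  · simp [antidiagonal, diagonal_mul, h]
  · simp [antidiagonal, diagonal_mul, h]

theorem antidiagonal_add_antidiagonal (a b : Fin n → R) :
    antidiagonal a + antidiagonal b = antidiagonal fun j => a j + b j := by
  ext i j
  by_cases h : j = Fin.rev i <;> simp [antidiagonal, h]

theorem isUnit_antidiagonal {K : Type*} [Field K] {a : Fin n → K} (ha : ∀ j, a j ≠ 0) :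
    IsUnit (antidiagonal a) := by
  refine IsUnit.of_mul_eq_one (antidiagonal fun j => (a (Fin.rev j))⁻¹) ?_
  simp [antidiagonal_mul_antidiagonal, ha]

end Matrix

/-- the block computation `G₀ · G₁⁻¹` producing the Weyl
`m`-function `M₁ⁿ(λ)` for the self-adjoint extension corresponding to the
kernel of `Γ₁` for the `n`-th power of the Jacobi operator. All vectors are
indexed by `Fin n`, corresponding to the paper's `1`-indexed
`γ_j, ε_j, δ_j, η_j` (so paper index `n + 1 - i` corresponds to `Fin.rev i`),
and `𝔍ₙ` is the antidiagonal matrix of `1`'s. -/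
theorem jacobi_power_weyl_m1_block_computation
    (n : ℕ) (hn : 1 ≤ n) (γ ε δ η : Fin n → ℂ)
    (hη : ∀ j, η j ≠ 0) (hW : ∀ j, γ j * η j - δ j * ε j = 1) :
    let J : Matrix (Fin n) (Fin n) ℂ := fun i j => if j = Fin.rev i then 1 else 0
    let A : Matrix (Fin n) (Fin n) ℂ := fun i j => if j = Fin.rev i then γ j else 0
    let B : Matrix (Fin n) (Fin n) ℂ := fun i j => if j = Fin.rev i then ε j else 0
    let C : Matrix (Fin n) (Fin n) ℂ := fun i j => if j = Fin.rev i then δ j else 0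
    let D : Matrix (Fin n) (Fin n) ℂ := fun i j => if j = Fin.rev i then η j else 0
    let G₀ : Matrix (Fin n ⊕ Fin n) (Fin n ⊕ Fin n) ℂ := Matrix.fromBlocks 0 J A B
    let G₁ : Matrix (Fin n ⊕ Fin n) (Fin n ⊕ Fin n) ℂ := Matrix.fromBlocks J 0 C D
    IsUnit G₁ ∧
      G₀ * G₁⁻¹ =
        Matrix.fromBlocks
          (Matrix.diagonal fun i => -δ (Fin.rev i) / η (Fin.rev i))
          (Matrix.diagonal fun i => (η (Fin.rev i))⁻¹)
          (Matrix.diagonal fun i => (η (Fin.rev i))⁻¹)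
          (Matrix.diagonal fun i => ε (Fin.rev i) / η (Fin.rev i)) := by
  intro J A B C D G₀ G₁
  have hJ : J = antidiagonal fun _ => 1 := rfl
  have hA : A = antidiagonal γ := rfl
  have hB : B = antidiagonal ε := rfl
  have hC : C = antidiagonal δ := rfl
  have hD : D = antidiagonal η := rfl
  have hG₁ : IsUnit G₁ := isUnit_fromBlocks_zero₁₂.mpr
    ⟨isUnit_antidiagonal fun _ => one_ne_zero, isUnit_antidiagonal hη⟩
  refine ⟨hG₁, ?_⟩
  have := hG₁.invertible
  rw [mul_inv_eq_iff_eq_mul_of_invertible]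
  simp only [G₀, G₁, hJ, hA, hB, hC, hD, fromBlocks_multiply, diagonal_mul_antidiagonal,
    antidiagonal_add_antidiagonal, mul_zero, zero_add, Fin.rev_rev]
  congr 1
  · ext i j
    simp [antidiagonal, div_eq_mul_inv, mul_comm]
  · congr 1
    funext j
    simp [hη j]
  · congr 1
    funext j
    field_simp [hη j]
    linear_combination hW j
  · congr 1
    funext j
    simp [hη j]
end
end
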